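/- Assume 0 < α < 1, a ≠ c, a + c + j ≠ 0, either (-N < a + c < -j + 1 and |c - a| > j) or ((a + c < -N + 1 or 0 < a + c) and |c - a| < 1), that the N+1 grid points y_0, …, y_N are pairwise distinct, and that the Pochhammer symbols (a+c)_{j+1}, (c-a)_{j+1}, (a-c)_{j+1}, (2a+1)_j, (2c+1)_j, (a)_j, (2a+1+j)_j, (a-c+1)_j, (a+c+j+1)_j, (c)_j, (2c+1+j)_j, (c-a+1)_j are all nonzero. Then the odd-case monic para-Racah polynomials satisfy the orthogonality relation Σ_{s=0}^{N} P_n(y_s) P_m(y_s) w_s = (u_1 u_2 ⋯ u_n) δ_{nm} for all 0 ≤ n, m ≤ N. -/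

import Mathlib

open Filter Topology Polynomial

noncomputable section

/-- The recurrence coefficient `bₙ` of the para-Racah polynomials, odd case `N = 2j+1`. -/
def bOdd (j : ℕ) (a c α : ℝ) (n : ℕ) : ℝ :=
  if n = j then
    -a ^ 2 - (j : ℝ) * (1 + a - c) * (1 + a + c + j) / 2 + α * (a - c) * (1 + (j : ℝ)) * (a + c + j)
  else if n = j + 1 then
    -a ^ 2 - (j : ℝ) * (1 + a - c) * (1 + a + c + j) / 2
      + (1 - α) * (a - c) * (1 + (j : ℝ)) * (a + c + j)
  else
    -(a * (a + j) + c * (c + j) + (n : ℝ) * ((2 * (j : ℝ) + 1) - n)) / 2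

/-- The recurrence coefficient `uₙ` of the para-Racah polynomials, odd case `N = 2j+1`. -/
def uOdd (j : ℕ) (a c α : ℝ) (n : ℕ) : ℝ :=
  if n = j + 1 then
    α * (1 - α) * (a - c) ^ 2 * (1 + (j : ℝ)) ^ 2 * (a + c + j) ^ 2
  else
    (n : ℝ) * ((2 * (j : ℝ) + 1) + 1 - n) * ((2 * (j : ℝ) + 1) - n + a + c) * ((n : ℝ) - 1 + a + c)
        * (((n : ℝ) - j - 1) ^ 2 - (a - c) ^ 2) /
      (4 * ((2 * (j : ℝ) + 1) - 2 * n) * ((2 * (j : ℝ) + 1) - 2 * n + 2))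

/-- Monic orthogonal polynomial sequence from a three-term recurrence:
`monicOPS b u n = (P_{n-1}, P_n)` with `P₋₁ = 0`, `P₀ = 1`,
`P_{n+1}(y) = (y - bₙ) Pₙ(y) - uₙ P_{n-1}(y)`. -/
def monicOPS (b u : ℕ → ℝ) : ℕ → Polynomial ℝ × Polynomial ℝ
  | 0 => (0, 1)
  | n + 1 =>
    ((monicOPS b u n).2,
      (X - C (b n)) * (monicOPS b u n).2 - C (u n) * (monicOPS b u n).1)

/-- The monic para-Racah polynomial `Pₙ`, odd case `N = 2j+1`. -/
def paraRacahOdd (j : ℕ) (a c α : ℝ) (n : ℕ) : Polynomial ℝ :=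
  (monicOPS (bOdd j a c α) (uOdd j a c α) n).2

/-- The Pochhammer symbol `(z)ₖ = z (z+1) ⋯ (z+k-1)`. -/
def poch (z : ℝ) (k : ℕ) : ℝ := ∏ i ∈ Finset.range k, (z + i)

/-- The quadratic bi-lattice: `y_{2s} = -(s+a)²`, `y_{2s+1} = -(s+c)²`. -/
def biLattice (a c : ℝ) (s : ℕ) : ℝ :=
  if s % 2 = 0 then -(((s / 2 : ℕ) : ℝ) + a) ^ 2 else -(((s / 2 : ℕ) : ℝ) + c) ^ 2

/-- The constant `κ_N`, odd case `N = 2j+1`. -/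
def kappaOdd (j : ℕ) (a c : ℝ) : ℝ :=
  poch (a - c - j) (2 * j + 1) * poch (a + c) (2 * j + 1) /
    (2 * (-1 : ℝ) ^ (j + 1) * (Nat.choose (2 * j) j) * (Nat.factorial j))

/-- The weights of the para-Racah polynomials, odd case `N = 2j+1`. -/
def wOdd (j : ℕ) (a c α : ℝ) (s : ℕ) : ℝ :=
  if s % 2 = 0 then
    2 * (1 - α) * kappaOdd j a c * poch (-(j : ℝ)) (s / 2) * poch (2 * a) (s / 2)
        * poch (a + 1) (s / 2) * poch (a - c - j) (s / 2) * poch (a + c) (s / 2) /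
      (poch (a + c) (j + 1) * poch (c - a) (j + 1) * poch (2 * a + 1) j
        * (Nat.factorial (s / 2)) * poch a (s / 2) * poch (2 * a + 1 + j) (s / 2)
        * poch (a - c + 1) (s / 2) * poch (a + c + j + 1) (s / 2))
  else
    -2 * α * kappaOdd j a c * poch (-(j : ℝ)) (s / 2) * poch (2 * c) (s / 2)
        * poch (c + 1) (s / 2) * poch (c - a - j) (s / 2) * poch (a + c) (s / 2) /
      (poch (a + c) (j + 1) * poch (a - c) (j + 1) * poch (2 * c + 1) j
        * (Nat.factorial (s / 2)) * poch c (s / 2) * poch (2 * c + 1 + j) (s / 2)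
        * poch (c - a + 1) (s / 2) * poch (a + c + j + 1) (s / 2))

def qPR (j : ℕ) (a c : ℝ) (i : ℕ) : ℝ :=
  ((i : ℝ) - j) * (a + c + i) * (a - c - j + i)

def phiPR (a : ℝ) (k : ℕ) (y : ℝ) : ℝ := ∏ i ∈ Finset.range k, (y + (a + i) ^ 2)

def cfPR (j : ℕ) (a c : ℝ) (n k : ℕ) : ℝ :=
  (Nat.choose n k : ℝ) * ∏ i ∈ Finset.Ico k n, (qPR j a c i / (2 * (j : ℝ) + 1 - n - i))

def pSPR (j : ℕ) (a c : ℝ) (n : ℕ) (y : ℝ) : ℝ :=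
  ∑ k ∈ Finset.range (j + 2), cfPR j a c n k * phiPR a k y

lemma cfPR_zero (j : ℕ) (a c : ℝ) (n k : ℕ) (h : n < k) : cfPR j a c n k = 0 := by
  simp [cfPR, Nat.choose_eq_zero_of_lt h]

lemma cfPR_self (j : ℕ) (a c : ℝ) (n : ℕ) : cfPR j a c n n = 1 := by
  simp [cfPR]

/-- Ratio in the lower index. -/
lemma cfPR_R1 (j : ℕ) (a c : ℝ) (n k : ℕ) (hn : n ≤ j) :
    cfPR j a c n k * (((n : ℝ) - k) * (2 * (j : ℝ) + 1 - n - k)) =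
      cfPR j a c n (k + 1) * ((k + 1) * qPR j a c k) := by
  rcases lt_trichotomy k n with h | h | h
  · have hne : (2 * (j : ℝ) + 1 - n - k) ≠ 0 := by
      have h1 : (k : ℝ) < n := by exact_mod_cast h
      have h2 : (n : ℝ) ≤ j := by exact_mod_cast hn
      intro h0; linarith
    have hch : (Nat.choose n (k + 1) : ℝ) * (k + 1) = Nat.choose n k * ((n : ℝ) - k) := by
      have := Nat.choose_succ_right_eq n k
      have h' : ((Nat.choose n (k + 1) * (k + 1) : ℕ) : ℝ) = ((Nat.choose n k * (n - k) : ℕ) : ℝ) := by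
        exact_mod_cast this
      push_cast [Nat.cast_sub h.le] at h'
      exact h'
    unfold cfPR
    rw [Finset.prod_eq_prod_Ico_succ_bot h]
    have : qPR j a c k / (2 * (j : ℝ) + 1 - n - k) * (2 * (j : ℝ) + 1 - n - k) = qPR j a c k := by
      field_simp
    linear_combination (exp := 1) (-(∏ i ∈ Finset.Ico (k + 1) n, (qPR j a c i / (2 * (j : ℝ) + 1 - n - i))) * qPR j a c k) * hch +
      ((Nat.choose n k : ℝ) * ((n : ℝ) - k) * (∏ i ∈ Finset.Ico (k + 1) n, (qPR j a c i / (2 * (j : ℝ) + 1 - n - i)))) * this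
  · subst h
    rw [cfPR_zero j a c k (k + 1) (by omega)]
    ring
  · rw [cfPR_zero j a c n k h, cfPR_zero j a c n (k + 1) (by omega)]
    ring

/-- Ratio in the upper index. -/
lemma cfPR_R2 (j : ℕ) (a c : ℝ) (n k : ℕ) (hn : n + 1 ≤ j) :
    cfPR j a c (n + 1) k * (((n : ℝ) + 1 - k) * (2 * (j : ℝ) + 1 - 2 * n) * (2 * (j : ℝ) - 2 * n)) =
      cfPR j a c n k * ((n + 1) * qPR j a c n * (2 * (j : ℝ) + 1 - n - k)) := by
  by_cases h : k ≤ n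
  · -- induct downward on k via the first relation
    obtain ⟨d, rfl⟩ := Nat.exists_eq_add_of_le h
    clear h
    induction d generalizing k with
    | zero =>
      have h1 := cfPR_R1 j a c (k + 1) k (by omega)
      simp only [Nat.add_zero] at *
      rw [cfPR_self] at h1 ⊢
      push_cast at h1
      have e : cfPR j a c (k + 1) k * ((k : ℝ) + 1 - k) * (2 * (j : ℝ) - 2 * k) =
          (k + 1) * qPR j a c k := by linear_combination h1
      linear_combination (2 * (j : ℝ) + 1 - 2 * k) * e
    | succ d ih =>
      have h1 := cfPR_R1 j a c (k + (d + 1) + 1) k (by omega)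
      have h2 := cfPR_R1 j a c (k + (d + 1)) k (by omega)
      have h3 := ih (k + 1) (by omega)
      rw [show k + 1 + d = k + (d + 1) by ring] at h3
      push_cast at h1 h2 h3 ⊢
      have hj : (k : ℝ) + d + 2 ≤ j := by
        have : ((k + (d + 1) + 1 : ℕ) : ℝ) ≤ j := by exact_mod_cast hn
        push_cast at this; linarith
      have hk : (0 : ℝ) ≤ k := by positivity
      have hd : (0 : ℝ) ≤ d := by positivity
      have hA : (2 * (j : ℝ) - (k + d + 1) - k) ≠ 0 := by intro h0; linarith
      have hB : ((d : ℝ) + 1) ≠ 0 := by positivity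
      apply mul_right_cancel₀ (mul_ne_zero hA hB)
      linear_combination ((2 * (j : ℝ) + 1 - 2 * (k + (d + 1))) * (2 * (j : ℝ) - 2 * (k + (d + 1))) * (d + 1)) * h1 +
        ((k + 1) * qPR j a c k) * h3 - ((k + d + 1 + 1) * qPR j a c (k + (d + 1)) * (2 * (j : ℝ) - (k + d + 1) - k)) * h2
  · rw [cfPR_zero j a c n k (by omega)]
    rcases Nat.lt_or_ge (n + 1) k with h' | h'
    · rw [cfPR_zero j a c (n + 1) k h']; ring
    · have : k = n + 1 := by omega
      subst this; push_cast; ring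

/-- Shifted coefficient. -/
def cfPR' (j : ℕ) (a c : ℝ) (n : ℕ) : ℕ → ℝ
  | 0 => 0
  | k + 1 => cfPR j a c n k

lemma cfPR'_rel (j : ℕ) (a c : ℝ) (n k : ℕ) (hn : n ≤ j) :
    cfPR' j a c n k * (((n : ℝ) + 1 - k) * (2 * (j : ℝ) + 2 - n - k)) =
      cfPR j a c n k * (k * (((k : ℝ) - 1 - j) * (a + c + k - 1) * (a - c - j + k - 1))) := by
  cases k with
  | zero => simp [cfPR']
  | succ k =>
    have := cfPR_R1 j a c n k hn
    simp only [cfPR', qPR] at *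
    push_cast
    linear_combination this

lemma pSPR_mul (j : ℕ) (a c : ℝ) (n : ℕ) (hn : n ≤ j) (y t : ℝ) :
    (y - t) * pSPR j a c n y =
      ∑ k ∈ Finset.range (j + 2), (cfPR' j a c n k - ((a + k) ^ 2 + t) * cfPR j a c n k) * phiPR a k y := by
  have h1 : ∑ k ∈ Finset.range (j + 2), cfPR' j a c n k * phiPR a k y =
      ∑ k ∈ Finset.range (j + 2), cfPR j a c n k * phiPR a (k + 1) y := by
    rw [Finset.sum_range_succ', Finset.sum_range_succ (n := j + 1)]
    rw [cfPR_zero j a c n (j + 1) (by omega)]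
    simp [cfPR']
  have h2 : ∀ k, phiPR a (k + 1) y = phiPR a k y * (y + (a + k) ^ 2) := by
    intro k; simp [phiPR, Finset.prod_range_succ]
  simp only [sub_mul, Finset.sum_sub_distrib]
  rw [h1]
  unfold pSPR
  rw [Finset.mul_sum, Finset.mul_sum, ← Finset.sum_sub_distrib, ← Finset.sum_sub_distrib]
  apply Finset.sum_congr rfl
  intro k _
  rw [h2]; ring

lemma pSPR_zero (j : ℕ) (a c : ℝ) (y : ℝ) : pSPR j a c 0 y = 1 := by
  unfold pSPR
  rw [Finset.sum_range_succ', Finset.sum_eq_zero]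
  · simp [cfPR_self, phiPR]
  · intro k _
    rw [cfPR_zero j a c 0 (k + 1) (by omega)]; ring

def bGen (j : ℕ) (a c : ℝ) (x : ℝ) : ℝ :=
  -(a * (a + j) + c * (c + j) + x * ((2 * (j : ℝ) + 1) - x)) / 2

def uGen (j : ℕ) (a c : ℝ) (n : ℝ) : ℝ :=
  (n : ℝ) * ((2 * (j : ℝ) + 1) + 1 - n) * ((2 * (j : ℝ) + 1) - n + a + c) * ((n : ℝ) - 1 + a + c)
        * (((n : ℝ) - j - 1) ^ 2 - (a - c) ^ 2) /
      (4 * ((2 * (j : ℝ) + 1) - 2 * n) * ((2 * (j : ℝ) + 1) - 2 * n + 2))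

lemma algRec (n p h a c x y y' z : ℝ) (e1 : p ≠ 0) (e2 : p + 1 ≠ 0) (e3 : 2 * h + 1 ≠ 0) (e4 : h ≠ 0)
   (e5 : 2 * h - 1 ≠ 0) (e6 : h - 1 ≠ 0) (e7 : 2 * h + p ≠ 0)
   (r0 : y' * ((p + 1) * (2 * h + p)) =
      y * ((n + 1 - p) * ((-p-h) * (a + c + n - p) * (a - c - h - p))))
   (r1 : y * (p * (2 * h + 1) * (2 * h)) = x * ((n + 1) * (-h * (a + c + n) * (a - c - h)) * (2 * h + p)))
   (r2 : z * ((p + 1) * (2 * h - 1) * (2 * (h - 1))) =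
      y * ((n + 2) * ((1-h) * (a + c + (n + 1)) * (a - c - h + 1)) * (2 * h + p -1))) :
   z = y' - ((a + (n + 1 - p)) ^ 2 + -(a * (a + (n + h)) + c * (c + (n + h)) + (n + 1) * (n + 2 * h)) / 2) * y
     - ((n + 1) * (n + 2 * h + 1) * (n + 2 * h + a + c) * (n + a + c) * (h ^ 2 - (a - c) ^ 2) /
      (4 * (2 * h - 1) * (2 * h + 1))) * x := by
  have hK : (p * (2 * h + 1) * (2 * h) * ((p + 1) * (2 * h - 1) * (2 * (h - 1)))) ≠ 0 := by positivity
  obtain ⟨t, ht⟩ : ∃ t, x = t * (p * (2 * h + 1) * (2 * h) * ((p + 1) * (2 * h - 1) * (2 * (h - 1)))) :=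
    ⟨x / _, (div_mul_cancel₀ x hK).symm⟩
  obtain ⟨A, hA⟩ : ∃ A, A = a + c + n := ⟨_, rfl⟩
  obtain ⟨B, hB⟩ : ∃ B, B = a - c - h := ⟨_, rfl⟩
  obtain ⟨T, hT⟩ : ∃ T, T = t * ((n + 1) * h * (h - 1) * A * B) := ⟨_, rfl⟩
  have hy : y = T * (-2 * (p + 1) * (2 * h - 1) * (2 * h + p)) := by
    apply mul_right_cancel₀ (show p * (2 * h + 1) * (2 * h) ≠ 0 by positivity)
    rw [r1, hT, ht, ← hA, ← hB]; ring
  have hy' : y' = T * (-2 * (2 * h - 1) * ((n + 1 - p) * ((-p-h) * (a + c + n - p) * (a - c - h - p)))) := by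
    apply mul_right_cancel₀ (mul_ne_zero e2 e7)
    rw [r0, hy]; ring
  have hz : z = T * ((2 * h + p) * (n + 2) * (a + c + (n + 1)) * (a - c - h + 1) * (2 * h + p - 1)) := by
    apply mul_right_cancel₀ (mul_ne_zero (mul_ne_zero e2 e5) (mul_ne_zero two_ne_zero e6))
    rw [r2, hy]; ring
  have hu : ∀ U V : ℝ, (n + 1) * U * V * (n + a + c) * (h ^ 2 - (a - c) ^ 2) /
      (4 * (2 * h - 1) * (2 * h + 1)) * x = T * (-U * V * (a - c + h) * p * (p + 1)) := by
    intro U V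
    have hB' : a - c = B + h := by rw [hB]; ring
    have hA' : n + a + c = A := by rw [hA]; ring
    rw [hA', hB', ht, hT, div_mul_eq_mul_div, div_eq_iff (by positivity)]
    ring
  rw [hu, hy, hy', hz]
  ring
lemma algTop (j p a c x y y' : ℝ) (e1 : p ≠ 0) (e2 : p + 1 ≠ 0) (e7 : 2 + p ≠ 0)
   (r0 : y' * ((p + 1) * (2 + p)) =
      y * ((j + 1 - p) * ((-p-1) * (a + c + j - p) * (a - c - 1 - p))))
   (r1 : y * (p * 6) = x * ((j + 1) * (- (a + c + j) * (a - c - 1)) * (2 + p))) :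
   0 = y' - ((a + (j + 1 - p)) ^ 2 + (-a ^ 2 - (j + 1) * (1 + a - c) * (2 + a + c + j) / 2)) * y
     - ((j + 1) * (j + 3) * (j + 2 + a + c) * (j + a + c) * (1 - (a - c) ^ 2) / 12) * x := by
  have r0' := eq_div_of_mul_eq (mul_ne_zero e2 e7) r0
  have r1' := eq_div_of_mul_eq (by positivity) r1
  rw [r0', r1']
  field_simp
  ring

lemma cf_rec (j : ℕ) (a c : ℝ) (n k : ℕ) (hn : n + 2 ≤ j) :
    cfPR j a c (n + 2) k = cfPR' j a c (n + 1) k -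
      ((a + k) ^ 2 + bGen j a c (n + 1)) * cfPR j a c (n + 1) k - uGen j a c (n + 1) * cfPR j a c n k := by
  have r0 := cfPR'_rel j a c (n + 1) k (by omega)
  have r1 := cfPR_R2 j a c n k (by omega)
  have r2 := cfPR_R2 j a c (n + 1) k (by omega)
  have hj : (n : ℝ) + 2 ≤ j := by exact_mod_cast hn
  have hn0 : (0 : ℝ) ≤ n := by positivity
  rcases lt_trichotomy k (n + 1) with h | h | h
  · have hk : (k : ℝ) ≤ n := by exact_mod_cast Nat.lt_succ_iff.mp h
    push_cast at r0 r1 r2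
    have key := algRec n (n + 1 - k) (j - n) a c (cfPR j a c n k) (cfPR j a c (n + 1) k)
      (cfPR' j a c (n + 1) k) (cfPR j a c (n + 2) k)
      (by intro h0; linarith) (by intro h0; linarith) (by intro h0; linarith) (by intro h0; linarith)
      (by intro h0; linarith) (by intro h0; linarith) (by intro h0; linarith)
      (by linear_combination r0) (by unfold qPR at r1; linear_combination r1)
      (by unfold qPR at r2; push_cast at r2; linear_combination r2)
    rw [key]
    unfold uGen bGen
    congr 1
    · ring
    · congr 1
      congr 1 <;> ring
  · subst h
    rw [cfPR_zero j a c n (n + 1) (by omega)]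
    rw [cfPR_self] at *
    push_cast at *
    have e5 : 2 * (j : ℝ) + 1 - 2 * (n + 1) ≠ 0 := by intro h0; linarith
    have e6 : 2 * (j : ℝ) - 2 * (n + 1) ≠ 0 := by intro h0; linarith
    have e7 : 2 * (j : ℝ) + 2 - (n + 1) - (n + 1) ≠ 0 := by intro h0; linarith
    have e8 : (j : ℝ) - n ≠ 0 := by intro h0; linarith
    have r0' : cfPR' j a c (n + 1) (n + 1) = -((n + 1) * (a + c + n) * (a - c - (j - n))) / 2 := by
      apply mul_right_cancel₀ e8
      linear_combination r0 / 2
    have r2' : cfPR j a c (n + 2) (n + 1) = -((n + 2) * (a + c + n + 1) * (a - c - (j - n) + 1)) / 2 := by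
      apply mul_right_cancel₀ (mul_ne_zero e5 e6)
      unfold qPR at r2
      push_cast at r2
      linear_combination r2
    rw [r0', r2']
    unfold bGen
    ring
  · rw [cfPR_zero j a c n k (by omega), cfPR_zero j a c (n + 1) k h]
    obtain ⟨k, rfl⟩ : ∃ k', k = k' + 1 := ⟨k - 1, by omega⟩
    simp only [cfPR']
    rcases Nat.lt_or_ge (n + 1) k with h' | h'
    · rw [cfPR_zero j a c (n + 2) _ (by omega), cfPR_zero j a c (n + 1) _ (by omega)]; ring
    · have : k = n + 1 := by omega
      subst this
      rw [cfPR_self, cfPR_self]; ring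

def betaPR (j : ℕ) (a c : ℝ) : ℝ :=
  -a ^ 2 - (j : ℝ) * (1 + a - c) * (1 + a + c + j) / 2

def cTop (j k : ℕ) : ℝ := if k = j + 1 then 1 else 0

lemma cf_top (j : ℕ) (a c : ℝ) (k : ℕ) :
    cTop (j + 1) k = cfPR' (j + 1) a c (j + 1) k -
      ((a + k) ^ 2 + betaPR (j + 1) a c) * cfPR (j + 1) a c (j + 1) k
        - uGen (j + 1) a c (j + 1) * cfPR (j + 1) a c j k := by
  have r0 := cfPR'_rel (j + 1) a c (j + 1) k (by omega)
  have r1 := cfPR_R2 (j + 1) a c j k (by omega)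
  have hn0 : (0 : ℝ) ≤ j := by positivity
  rcases lt_trichotomy k (j + 1) with h | h | h
  · have hk : (k : ℝ) ≤ j := by exact_mod_cast Nat.lt_succ_iff.mp h
    rw [cTop, if_neg (by omega)]
    push_cast at r0 r1
    have key := algTop j (j + 1 - k) a c (cfPR (j + 1) a c j k) (cfPR (j + 1) a c (j + 1) k)
      (cfPR' (j + 1) a c (j + 1) k)
      (by intro h0; linarith) (by intro h0; linarith) (by intro h0; linarith)
      (by linear_combination r0) (by unfold qPR at r1; push_cast at r1; linear_combination r1)
    rw [key]
    unfold uGen betaPR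
    push_cast
    congr 1
    · ring
    · congr 1
      rw [div_eq_div_iff (by norm_num) (by intro h0; ring_nf at h0; norm_num at h0)]
      ring
  · subst h
    rw [cTop, if_neg (by omega)]
    rw [cfPR_zero (j + 1) a c j (j + 1) (by omega)]
    rw [cfPR_self] at *
    push_cast at *
    unfold betaPR
    push_cast
    linear_combination -r0 / 2
  · rw [cfPR_zero (j + 1) a c j k (by omega), cfPR_zero (j + 1) a c (j + 1) k h]
    obtain ⟨k, rfl⟩ : ∃ k', k = k' + 1 := ⟨k - 1, by omega⟩
    simp only [cfPR', cTop]
    rcases Nat.lt_or_ge (j + 1) k with h' | h'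
    · rw [if_neg (by omega), cfPR_zero (j + 1) a c (j + 1) _ (by omega)]; ring
    · have : k = j + 1 := by omega
      subst this
      rw [cfPR_self, if_pos rfl]; ring

lemma pSPR_rec (j : ℕ) (a c : ℝ) (n : ℕ) (hn : n + 2 ≤ j) (y : ℝ) :
    pSPR j a c (n + 2) y = (y - bGen j a c (n + 1)) * pSPR j a c (n + 1) y
      - uGen j a c (n + 1) * pSPR j a c n y := by
  rw [pSPR_mul j a c (n + 1) (by omega)]
  unfold pSPR
  rw [Finset.mul_sum, ← Finset.sum_sub_distrib]
  apply Finset.sum_congr rfl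
  intro k _
  rw [cf_rec j a c n k hn]; ring

lemma pSPR_top (j : ℕ) (a c : ℝ) (y : ℝ) :
    phiPR a (j + 2) y = (y - betaPR (j + 1) a c) * pSPR (j + 1) a c (j + 1) y
      - uGen (j + 1) a c (j + 1) * pSPR (j + 1) a c j y := by
  rw [pSPR_mul (j + 1) a c (j + 1) (by omega)]
  have : phiPR a (j + 2) y = ∑ k ∈ Finset.range (j + 1 + 2), cTop (j + 1) k * phiPR a k y := by
    simp [cTop]
  rw [this]
  unfold pSPR
  rw [Finset.mul_sum, ← Finset.sum_sub_distrib]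
  apply Finset.sum_congr rfl
  intro k _
  rw [cf_top j a c k]; ring

lemma pSPR_one (j : ℕ) (a c : ℝ) (y : ℝ) :
    pSPR (j + 1) a c 1 y = y - bGen (j + 1) a c 0 := by
  unfold pSPR
  rw [Finset.sum_range_succ', Finset.sum_range_succ', Finset.sum_eq_zero]
  · have := cfPR_R1 (j + 1) a c 1 0 (by omega)
    simp only [zero_add, cfPR_self, qPR] at *
    have hn0 : (0 : ℝ) ≤ j := by positivity
    push_cast at this
    have e : cfPR (j + 1) a c 1 0 = -((a + c) * (a - c - (j + 1))) / 2 := by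
      have h2 : (j : ℝ) + 1 ≠ 0 := by positivity
      apply mul_right_cancel₀ h2
      linear_combination this / 2
    rw [e]
    simp [phiPR, bGen]
    ring
  · intro k _
    rw [cfPR_zero (j + 1) a c 1 _ (by omega)]; ring

lemma poch_succ (z : ℝ) (k : ℕ) : poch z (k + 1) = poch z k * (z + k) := by
  simp [poch, Finset.prod_range_succ]

lemma poch_zero (z : ℝ) : poch z 0 = 1 := by simp [poch]

lemma poch_add (z : ℝ) (m k : ℕ) : poch z (m + k) = poch z m * poch (z + m) k := by
  unfold poch
  rw [Finset.prod_range_add]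
  congr 1
  apply Finset.prod_congr rfl
  intro i _
  push_cast; ring

lemma poch_ne_iff (z : ℝ) (k : ℕ) : poch z k ≠ 0 ↔ ∀ i < k, z + i ≠ 0 := by
  simp [poch, Finset.prod_ne_zero_iff]

lemma poch_reflect (z : ℝ) (k : ℕ) : poch z (k + 1) = (-1) ^ (k + 1) * poch (-z - k) (k + 1) := by
  unfold poch
  rw [← Finset.prod_range_reflect (fun i : ℕ => (-z - k + i : ℝ))]
  rw [← Finset.card_range (k + 1), ← Finset.prod_const, Finset.card_range, ← Finset.prod_mul_distrib]
  apply Finset.prod_congr rfl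
  intro i hi
  have : i ≤ k := Nat.lt_succ_iff.mp (Finset.mem_range.mp hi)
  rw [show k + 1 - 1 - i = k - i by omega, Nat.cast_sub this]
  ring

lemma poch_shift (z : ℝ) (k : ℕ) : z * poch (z + 1) k = poch z k * (z + k) := by
  rw [← poch_succ, Nat.add_comm, poch_add]
  simp [poch]

lemma poch_neg_nat (j : ℕ) : poch (-(j : ℝ)) j = (-1) ^ j * (Nat.factorial j : ℝ) := by
  induction j with
  | zero => simp [poch]
  | succ j ih =>
    have h := poch_shift (-((j + 1 : ℕ) : ℝ)) j
    rw [show -((j + 1 : ℕ) : ℝ) + 1 = -(j : ℝ) by push_cast; ring] at h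
    rw [poch_succ, ← h, ih, Nat.factorial_succ, pow_succ]
    push_cast; ring

lemma poch_neg_two (j : ℕ) : poch (-(2 * (j : ℝ))) j =
    (-1) ^ j * ((Nat.choose (2 * j) j : ℝ) * (Nat.factorial j : ℝ)) := by
  have h1 := poch_neg_nat (2 * j)
  have h2 := poch_add (-((2 * j : ℕ) : ℝ)) j j
  rw [show j + j = 2 * j by ring, h1] at h2
  rw [show -((2 * j : ℕ) : ℝ) + j = -(j : ℝ) by push_cast; ring, poch_neg_nat] at h2
  have h3 := Nat.choose_mul_factorial_mul_factorial (show j ≤ 2 * j by omega)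
  rw [show 2 * j - j = j by omega] at h3
  have h4 : (Nat.choose (2 * j) j : ℝ) * (Nat.factorial j : ℝ) * (Nat.factorial j : ℝ) = (Nat.factorial (2 * j) : ℝ) := by
    exact_mod_cast h3
  rw [← h4] at h2
  have hf : (Nat.factorial j : ℝ) ≠ 0 := by exact_mod_cast Nat.factorial_ne_zero j
  have he : ((-1 : ℝ) ^ j) ≠ 0 := by positivity
  have he2 : ((-1 : ℝ) ^ (2 * j)) = (-1) ^ j * (-1) ^ j := by rw [two_mul, pow_add]
  rw [he2] at h2
  push_cast at h2
  apply mul_right_cancel₀ (mul_ne_zero he hf)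
  rw [← h2]; ring

def WA (j : ℕ) (a c : ℝ) (s : ℕ) : ℝ :=
  2 * kappaOdd j a c * poch (-(j : ℝ)) s * poch (2 * a) s
        * poch (a + 1) s * poch (a - c - j) s * poch (a + c) s /
      (poch (a + c) (j + 1) * poch (c - a) (j + 1) * poch (2 * a + 1) j
        * (Nat.factorial s) * poch a s * poch (2 * a + 1 + j) s
        * poch (a - c + 1) s * poch (a + c + j + 1) s)

/-- Nonvanishing conditions. -/
structure GoodPR (j : ℕ) (a c : ℝ) : Prop where
  h1 : ∀ i : ℕ, i ≤ 2 * j → a + c + i ≠ 0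
  h2 : ∀ i : ℕ, i ≤ j → a - c + i ≠ 0
  h2' : ∀ i : ℕ, i ≤ j → c - a + i ≠ 0
  h3 : ∀ i : ℕ, i < 2 * j → 2 * a + 1 + i ≠ 0
  h4 : ∀ i : ℕ, i ≤ j → a + i ≠ 0

lemma frac_step (K P1 P2 P3 P4 P5 D F Q1 Q2 Q3 Q4 n1 n2 n3 n4 n5 f d1 d2 d3 d4 : ℝ)
    (hf : f ≠ 0) (h1 : d1 ≠ 0) (h2 : d2 ≠ 0) (h3 : d3 ≠ 0) (h4 : d4 ≠ 0) :
    (K * (P1 * n1) * (P2 * n2) * (P3 * n3) * (P4 * n4) * (P5 * n5)) /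
      (D * (f * F) * (Q1 * d1) * (Q2 * d2) * (Q3 * d3) * (Q4 * d4)) * (f * d1 * d2 * d3 * d4) =
    (K * P1 * P2 * P3 * P4 * P5) / (D * F * Q1 * Q2 * Q3 * Q4) * (n1 * n2 * n3 * n4 * n5) := by
  have e1 : K * (P1 * n1) * (P2 * n2) * (P3 * n3) * (P4 * n4) * (P5 * n5) =
    (K * P1 * P2 * P3 * P4 * P5) * (n1 * n2 * n3 * n4 * n5) := by ring
  have e2 : D * (f * F) * (Q1 * d1) * (Q2 * d2) * (Q3 * d3) * (Q4 * d4) =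
    (D * F * Q1 * Q2 * Q3 * Q4) * (f * d1 * d2 * d3 * d4) := by ring
  have e3 : f * d1 * d2 * d3 * d4 ≠ 0 := by positivity
  rw [e1, e2, mul_div_mul_comm, mul_assoc, div_mul_cancel₀ _ e3]

lemma WA_rec (j : ℕ) (a c : ℝ) (g : GoodPR j a c) (s : ℕ) (hs : s < j) :
    WA j a c (s + 1) * (((s : ℝ) + 1) * (a + s) * (2 * a + 1 + j + s) * (a - c + 1 + s) * (a + c + j + 1 + s)) =
      WA j a c s * ((-(j : ℝ) + s) * (2 * a + s) * (a + 1 + s) * (a - c - j + s) * (a + c + s)) := by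
  unfold WA
  simp only [poch_succ _ s, Nat.factorial_succ]
  push_cast
  apply frac_step
  · positivity
  · exact g.h4 s hs.le
  · have := g.h3 (j + s) (by omega)
    push_cast at this
    rwa [← add_assoc] at this
  · have := g.h2 (s + 1) (by omega)
    push_cast at this
    intro h0; apply this; linarith
  · have := g.h1 (j + 1 + s) (by omega)
    push_cast at this
    intro h0; apply this; linarith

lemma phi_rel (a : ℝ) (k s : ℕ) :
    phiPR a k (-(((s + 1 : ℕ) : ℝ) + a) ^ 2) * (((s : ℝ) + 1 - k) * (2 * a + s)) =
      phiPR a k (-((s : ℝ) + a) ^ 2) * (((s : ℝ) + 1) * (2 * a + s + k)) := by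
  induction k with
  | zero => simp [phiPR]
  | succ k ih =>
    have h2 : ∀ y, phiPR a (k + 1) y = phiPR a k y * (y + (a + k) ^ 2) := by
      intro y; simp [phiPR, Finset.prod_range_succ]
    rw [h2, h2]
    push_cast at ih ⊢
    linear_combination (-((s : ℝ) - k) * (2 * a + k + s + 1)) * ih

lemma phi_zero (a : ℝ) (k s : ℕ) (h : s < k) : phiPR a k (-((s : ℝ) + a) ^ 2) = 0 := by
  unfold phiPR
  apply Finset.prod_eq_zero (Finset.mem_range.mpr h)
  ring

lemma phi_poch (a : ℝ) (k s : ℕ) :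
    phiPR a k (-((s : ℝ) + a) ^ 2) = poch (-(s : ℝ)) k * poch (2 * a + s) k := by
  unfold phiPR poch
  rw [← Finset.prod_mul_distrib]
  apply Finset.prod_congr rfl
  intro i _
  ring

def HG (j : ℕ) (a c : ℝ) (k s : ℕ) : ℝ :=
  WA j a c s / (a + s) * phiPR a k (-((s : ℝ) + a) ^ 2) *
    (((s : ℝ) - k) * (s + 2 * a + j) * (s + a - c) * (s + a + c + j))

lemma HG_succ (j : ℕ) (a c : ℝ) (g : GoodPR j a c) (k s : ℕ) (hs : s < j) :
    HG j a c k (s + 1) = WA j a c s / (a + s) * phiPR a k (-((s : ℝ) + a) ^ 2) *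
      ((2 * a + s + k) * (-(j : ℝ) + s) * (a - c - j + s) * (a + c + s)) := by
  have e1 := g.h4 s hs.le
  have e2 := g.h4 (s + 1) hs
  have e3 : 2 * a + s ≠ 0 := by
    rcases Nat.eq_zero_or_pos s with h | h
    · subst h
      simpa using e1
    · have := g.h3 (s - 1) (by omega)
      rw [Nat.cast_sub h] at this
      intro h0; apply this; push_cast; linarith
  have e4 : (s : ℝ) + 1 ≠ 0 := by positivity
  have hW := WA_rec j a c g s hs
  have hp := phi_rel a k s
  obtain ⟨v, hv⟩ : ∃ v, v = WA j a c s / (a + s) := ⟨_, rfl⟩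
  obtain ⟨v', hv'⟩ : ∃ v', v' = WA j a c (s + 1) / (a + (s + 1 : ℕ)) := ⟨_, rfl⟩
  have hv1 : WA j a c s = v * (a + s) := by rw [hv, div_mul_cancel₀ _ e1]
  have hv1' : WA j a c (s + 1) = v' * (a + (s + 1 : ℕ)) := by rw [hv', div_mul_cancel₀ _ e2]
  unfold HG
  rw [← hv, ← hv']
  rw [hv1, hv1'] at hW
  generalize phiPR a k (-(((s + 1 : ℕ) : ℝ) + a) ^ 2) = f' at *
  generalize phiPR a k (-((s : ℝ) + a) ^ 2) = f at *
  push_cast at *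
  have hV : v' * (((s : ℝ) + 1) * ((2 * a + 1 + j + s) * (a - c + 1 + s) * (a + c + j + 1 + s))) =
      v * ((2 * a + s) * ((-(j : ℝ) + s) * (a - c - j + s) * (a + c + s))) := by
    apply mul_right_cancel₀ (mul_ne_zero e1 e2)
    linear_combination hW
  have hX : ((s : ℝ) + 1 + 2 * a + j) * (s + 1 + a - c) * (s + 1 + a + c + j) =
    ((2 * a + 1 + j + s) * (a - c + 1 + s) * (a + c + j + 1 + s)) := by ring
  have hX' : v' * f' * (((s : ℝ) + 1 - k) * (s + 1 + 2 * a + j) * (s + 1 + a - c) * (s + 1 + a + c + j)) =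
     v' * f' * ((s + 1 - k) * ((2 * a + 1 + j + s) * (a - c + 1 + s) * (a + c + j + 1 + s))) := by
    rw [← hX]; ring
  rw [hX']
  generalize (2 * a + 1 + j + s) * (a - c + 1 + s) * (a + c + j + 1 + s) = X at *
  have hY : v * f * ((2 * a + s + k) * (-(j : ℝ) + s) * (a - c - j + s) * (a + c + s)) =
    v * f * ((2 * a + s + k) * ((-(j : ℝ) + s) * (a - c - j + s) * (a + c + s))) := by ring
  rw [hY]
  generalize (-(j : ℝ) + s) * (a - c - j + s) * (a + c + s) = Y at *
  apply mul_right_cancel₀ (mul_ne_zero e3 e4)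
  linear_combination (f' * (s + 1 - k) * (2 * a + s)) * hV + (v * Y * (2 * a + s)) * hp

def MM (j : ℕ) (a c : ℝ) (k : ℕ) : ℝ :=
  ∑ s ∈ Finset.range (j + 1), WA j a c s * phiPR a k (-((s : ℝ) + a) ^ 2)

lemma MM_rec (j : ℕ) (a c : ℝ) (g : GoodPR j a c) (k : ℕ) :
    ((k : ℝ) - 2 * j) * MM j a c (k + 1) = qPR j a c k * MM j a c k := by
  have key : ∀ s : ℕ, a + s ≠ 0 → WA j a c s * phiPR a k (-((s : ℝ) + a) ^ 2) *
      ((4 * j - 2 * k) * (-((s : ℝ) + a) ^ 2 + (a + k) ^ 2) + 2 * qPR j a c k) =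
      WA j a c s / (a + s) * phiPR a k (-((s : ℝ) + a) ^ 2) *
        ((2 * a + s + k) * (-(j : ℝ) + s) * (a - c - j + s) * (a + c + s)) - HG j a c k s := by
    intro s h
    obtain ⟨v, hv⟩ : ∃ v, v = WA j a c s / (a + s) := ⟨_, rfl⟩
    have hv1 : WA j a c s = v * (a + s) := by rw [hv, div_mul_cancel₀ _ h]
    unfold HG
    rw [← hv, hv1]
    unfold qPR
    ring
  have hsum : ∀ m : ℕ, m ≤ j → ∑ s ∈ Finset.range m, WA j a c s * phiPR a k (-((s : ℝ) + a) ^ 2) *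
      ((4 * j - 2 * k) * (-((s : ℝ) + a) ^ 2 + (a + k) ^ 2) + 2 * qPR j a c k) = HG j a c k m := by
    intro m
    induction m with
    | zero =>
      intro _
      simp only [Finset.range_zero, Finset.sum_empty]
      cases k with
      | zero => simp [HG]
      | succ k => unfold HG; rw [phi_zero a (k + 1) 0 (by omega)]; ring
    | succ m ih =>
      intro hm
      rw [Finset.sum_range_succ, ih (by omega), key m (g.h4 m (by omega)), HG_succ j a c g k m (by omega)]
      ring
  have htot : ∑ s ∈ Finset.range (j + 1), WA j a c s * phiPR a k (-((s : ℝ) + a) ^ 2) *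
      ((4 * j - 2 * k) * (-((s : ℝ) + a) ^ 2 + (a + k) ^ 2) + 2 * qPR j a c k) = 0 := by
    rw [Finset.sum_range_succ, hsum j le_rfl, key j (g.h4 j le_rfl)]
    ring
  have h2 : ∀ y, phiPR a (k + 1) y = phiPR a k y * (y + (a + k) ^ 2) := by
    intro y; simp [phiPR, Finset.prod_range_succ]
  have : (4 * j - 2 * k) * MM j a c (k + 1) + 2 * qPR j a c k * MM j a c k = 0 := by
    rw [← htot]
    unfold MM
    rw [Finset.mul_sum, Finset.mul_sum, ← Finset.sum_add_distrib]
    apply Finset.sum_congr rfl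
    intro s _
    rw [h2]; ring
  linear_combination -this / 2

lemma norm_alg (A1 A2 B1 B2 e C f P2a P2aj Pa1 Pa P2a1 P2a1j Q R : ℝ)
    (he : e * e = 1) (hA1 : A1 ≠ 0) (hA2 : A2 ≠ 0) (hB1 : B1 ≠ 0) (hB2 : B2 ≠ 0) (hC : C ≠ 0) (hf : f ≠ 0)
    (hPa : Pa ≠ 0) (hP1 : P2a1 ≠ 0) (hP2 : P2a1j ≠ 0) (hF4 : P2a * P2aj * Pa1 = Pa * P2a1 * P2a1j) :
    (2 * (B1 * B2 * (A1 * A2) / (2 * (-e) * C * f)) * (e * f) * P2a * Pa1 * R * Q /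
      (A1 * (-e * B1) * P2a1 * f * Pa * P2a1j * B2 * A2)) * ((e * f) * P2aj) * (e * (C * f)) = e * f * Q * R := by
  have he0 : e ≠ 0 := by intro h; rw [h] at he; norm_num at he
  have e1 : 2 * (B1 * B2 * (A1 * A2) / (2 * (-e) * C * f)) * (e * f) * P2a * Pa1 * R * Q =
     -(B1 * B2 * A1 * A2 / C) * (P2a * Pa1) * R * Q := by
    field_simp
  rw [e1, div_mul_eq_mul_div, div_mul_eq_mul_div, div_eq_iff (by simp [*])]
  have e2 : -(B1 * B2 * A1 * A2 / C) * (P2a * Pa1) * R * Q * (e * f * P2aj) * (e * (C * f)) =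
    -(B1 * B2 * A1 * A2 / C * C) * (P2a * P2aj * Pa1) * R * Q * f * f * (e * e) := by ring
  rw [e2, hF4, div_mul_cancel₀ _ hC]
  ring

lemma MM_zero (j : ℕ) (a c : ℝ) (g : GoodPR j a c) (hj : 1 ≤ j) : MM j a c 0 = 1 := by
  have hind : ∀ m : ℕ, poch (-(2 * (j : ℝ))) m * MM j a c m =
      poch (-(j : ℝ)) m * poch (a + c) m * poch (a - c - j) m * MM j a c 0 := by
    intro m
    induction m with
    | zero => simp [poch]
    | succ m ih =>
      have := MM_rec j a c g m
      unfold qPR at this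
      simp only [poch_succ]
      linear_combination poch (-(2 * (j : ℝ))) m * this + ((m : ℝ) - j) * (a + c + m) * (a - c - j + m) * ih
  have hMj : MM j a c j = WA j a c j * phiPR a j (-((j : ℝ) + a) ^ 2) := by
    unfold MM
    rw [Finset.sum_range_succ, Finset.sum_eq_zero, zero_add]
    intro s hs
    rw [phi_zero a j s (Finset.mem_range.mp hs), mul_zero]
  have q1 : poch (-(j : ℝ)) j ≠ 0 := by
    rw [poch_neg_nat]
    have : (Nat.factorial j : ℝ) ≠ 0 := by exact_mod_cast Nat.factorial_ne_zero j
    positivity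
  have hA1 : poch (a + c) (j + 1) ≠ 0 := by
    rw [poch_ne_iff]; intro i hi; exact g.h1 i (by omega)
  have hA1' : poch (a + c) j ≠ 0 := by
    rw [poch_ne_iff]; intro i hi; exact g.h1 i (by omega)
  have hA2 : poch (a + c + j + 1) j ≠ 0 := by
    rw [poch_ne_iff]; intro i hi
    have := g.h1 (j + 1 + i) (by omega)
    push_cast at this
    intro h0; apply this; linarith
  have hB1 : poch (a - c - j) (j + 1) ≠ 0 := by
    rw [poch_ne_iff]; intro i hi
    have := g.h2' (j - i) (by omega)
    rw [Nat.cast_sub (by omega)] at this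
    intro h0; apply this; linarith
  have hB1' : poch (a - c - j) j ≠ 0 := by
    rw [poch_succ] at hB1; exact left_ne_zero_of_mul hB1
  have hB2 : poch (a - c + 1) j ≠ 0 := by
    rw [poch_ne_iff]; intro i hi
    have := g.h2 (i + 1) (by omega)
    push_cast at this
    intro h0; apply this; linarith
  have hPa : poch a j ≠ 0 := by
    rw [poch_ne_iff]; intro i hi; exact g.h4 i (by omega)
  have hP1 : poch (2 * a + 1) j ≠ 0 := by
    rw [poch_ne_iff]; intro i hi; exact g.h3 i (by omega)
  have hP2 : poch (2 * a + 1 + j) j ≠ 0 := by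
    rw [poch_ne_iff]; intro i hi
    have := g.h3 (j + i) (by omega)
    push_cast at this
    intro h0; apply this; linarith
  have ha0 : a ≠ 0 := by simpa using g.h4 0 (by omega)
  have haj : a + j ≠ 0 := g.h4 j le_rfl
  have hF4 : poch (2 * a) j * poch (2 * a + j) j * poch (a + 1) j =
      poch a j * poch (2 * a + 1) j * poch (2 * a + 1 + j) j := by
    have f1 := poch_shift a j
    have f2 := poch_shift (2 * a) (j + j)
    rw [poch_add, poch_add] at f2
    push_cast at f2
    apply mul_right_cancel₀ (mul_ne_zero ha0 haj)
    linear_combination (poch (2 * a) j * poch (2 * a + j) j * (a + j)) * f1 - (poch a j * (a + j) / 2) * f2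
  have hfin : WA j a c j * phiPR a j (-((j : ℝ) + a) ^ 2) * poch (-(2 * (j : ℝ))) j =
      poch (-(j : ℝ)) j * poch (a + c) j * poch (a - c - j) j := by
    rw [phi_poch, poch_neg_two]
    unfold WA kappaOdd
    have k1 : poch (a + c) (2 * j + 1) = poch (a + c) (j + 1) * poch (a + c + j + 1) j := by
      rw [show 2 * j + 1 = (j + 1) + j by ring, poch_add]
      push_cast; rw [← add_assoc]
    have k2 : poch (a - c - j) (2 * j + 1) = poch (a - c - j) (j + 1) * poch (a - c + 1) j := by
      rw [show 2 * j + 1 = (j + 1) + j by ring, poch_add]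
      push_cast
      rw [show a - c - (j : ℝ) + (j + 1) = a - c + 1 by ring]
    have k3 : poch (c - a) (j + 1) = -(-1) ^ j * poch (a - c - j) (j + 1) := by
      rw [poch_reflect (c - a), pow_succ, show -(c - a) - (j : ℝ) = a - c - j by ring]
      ring
    rw [k1, k2, k3, poch_neg_nat, pow_succ, mul_neg_one]
    refine norm_alg _ _ _ _ _ _ _ _ _ _ _ _ _ _ _ ?_ hA1 hA2 hB1 hB2 ?_ ?_ hPa hP1 hP2 hF4
    · rw [← mul_pow]; norm_num
    · have := Nat.choose_pos (show j ≤ 2 * j by omega)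
      exact_mod_cast this.ne'
    · exact_mod_cast Nat.factorial_ne_zero j
  have h0 := hind j
  rw [hMj] at h0
  apply mul_left_cancel₀ (mul_ne_zero (mul_ne_zero q1 hA1') hB1')
  rw [← h0, mul_one, ← hfin]
  ring

lemma LA_pS (j : ℕ) (a c : ℝ) (g : GoodPR j a c) (hj : 1 ≤ j) (n : ℕ) (hn : n ≤ j) :
    ∑ s ∈ Finset.range (j + 1), WA j a c s * pSPR j a c n (-((s : ℝ) + a) ^ 2) = if n = 0 then 1 else 0 := by
  split_ifs with h
  · subst h
    simp only [pSPR_zero]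
    have h0 := MM_zero j a c g hj
    simpa [MM, phiPR] using h0
  · have hsw : ∑ s ∈ Finset.range (j + 1), WA j a c s * pSPR j a c n (-((s : ℝ) + a) ^ 2) =
        ∑ k ∈ Finset.range (j + 2), cfPR j a c n k * MM j a c k := by
      unfold pSPR MM
      simp only [Finset.mul_sum]
      rw [Finset.sum_comm]
      apply Finset.sum_congr rfl; intro k _
      apply Finset.sum_congr rfl; intro s _
      ring
    have htel : ∀ m : ℕ, (n : ℝ) * (2 * j + 1 - n) * ∑ k ∈ Finset.range m, cfPR j a c n k * MM j a c k =
        m * (m - 1 - 2 * j) * (cfPR j a c n m * MM j a c m) := by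
      intro m
      induction m with
      | zero => simp
      | succ m ih =>
        have r1 := cfPR_R1 j a c n m hn
        have r2 := MM_rec j a c g m
        rw [Finset.sum_range_succ, mul_add, ih]
        push_cast
        linear_combination MM j a c m * r1 - cfPR j a c n (m + 1) * (m + 1) * r2
    have := htel (j + 2)
    rw [cfPR_zero j a c n (j + 2) (by omega)] at this
    rw [hsw]
    have hn1 : (1 : ℝ) ≤ n := by exact_mod_cast Nat.one_le_iff_ne_zero.mpr h
    have hn2 : (n : ℝ) ≤ j := by exact_mod_cast hn
    have e : (n : ℝ) * (2 * j + 1 - n) ≠ 0 := by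
      apply mul_ne_zero <;> intro h0 <;> linarith
    apply mul_left_cancel₀ e
    rw [this]; ring

lemma ev_zero (j : ℕ) (a c α y : ℝ) : (paraRacahOdd j a c α 0).eval y = 1 := by
  simp [paraRacahOdd, monicOPS]

lemma ev_one (j : ℕ) (a c α y : ℝ) : (paraRacahOdd j a c α 1).eval y = y - bOdd j a c α 0 := by
  simp [paraRacahOdd, monicOPS]

lemma ev_succ (j : ℕ) (a c α y : ℝ) (n : ℕ) : (paraRacahOdd j a c α (n + 2)).eval y =
    (y - bOdd j a c α (n + 1)) * (paraRacahOdd j a c α (n + 1)).eval y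
      - uOdd j a c α (n + 1) * (paraRacahOdd j a c α n).eval y := by
  simp [paraRacahOdd, monicOPS]

lemma bOdd_gen (j : ℕ) (a c α : ℝ) (n : ℕ) (h : n ≠ j) (h' : n ≠ j + 1) :
    bOdd j a c α n = bGen j a c n := by
  unfold bOdd bGen
  rw [if_neg h, if_neg h']

lemma uOdd_gen (j : ℕ) (a c α : ℝ) (n : ℕ) (h : n ≠ j + 1) :
    uOdd j a c α n = uGen j a c n := by
  unfold uOdd uGen
  rw [if_neg h]

lemma paraRacahOdd_swap (j : ℕ) (a c α : ℝ) (n : ℕ) :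
    paraRacahOdd j a c α n = paraRacahOdd j c a (1 - α) n := by
  have hb : bOdd j a c α = bOdd j c a (1 - α) := by
    funext k
    unfold bOdd
    split_ifs <;> ring
  have hu : uOdd j a c α = uOdd j c a (1 - α) := by
    funext k
    unfold uOdd
    split_ifs
    · ring
    · congr 1; ring
  unfold paraRacahOdd
  rw [hb, hu]

lemma ev_eq (j : ℕ) (a c α y : ℝ) : ∀ n : ℕ, n ≤ j →
    (paraRacahOdd j a c α n).eval y = pSPR j a c n y := by
  intro n
  induction n using Nat.strong_induction_on with
  | _ n ih =>
    intro hn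
    match n, ih, hn with
    | 0, _, _ => rw [ev_zero, pSPR_zero]
    | 1, _, hn =>
      obtain ⟨i, rfl⟩ : ∃ i, j = i + 1 := ⟨j - 1, by omega⟩
      rw [ev_one, pSPR_one, bOdd_gen _ _ _ _ _ (by omega) (by omega)]
      simp
    | n + 2, ih, hn =>
      rw [ev_succ, pSPR_rec j a c n hn, ih (n + 1) (by omega) (by omega), ih n (by omega) (by omega),
        bOdd_gen _ _ _ _ _ (by omega) (by omega), uOdd_gen _ _ _ _ _ (by omega)]
      push_cast
      rfl

def deltaPR (j : ℕ) (a c : ℝ) : ℝ := (a - c) * (1 + (j : ℝ)) * (a + c + j)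

lemma uOdd_zero (j : ℕ) (a c α : ℝ) : uOdd j a c α 0 = 0 := by
  rw [uOdd_gen _ _ _ _ _ (by omega)]
  simp [uGen]

lemma bOdd_sym (j k : ℕ) (a c α : ℝ) (hk : k + 1 ≤ j) :
    bOdd j a c α (j + 2 + k) = bOdd j a c α (j - k - 1) := by
  rw [bOdd_gen _ _ _ _ _ (by omega) (by omega), bOdd_gen _ _ _ _ _ (by omega) (by omega)]
  rw [Nat.sub_sub, Nat.cast_sub hk]
  unfold bGen
  push_cast
  ring

lemma uOdd_sym (j k : ℕ) (a c α : ℝ) (hk : k + 1 ≤ j) :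
    uOdd j a c α (j + 2 + k) = uOdd j a c α (j - k) := by
  rw [uOdd_gen _ _ _ _ _ (by omega), uOdd_gen _ _ _ _ _ (by omega)]
  rw [Nat.cast_sub (by omega)]
  unfold uGen
  push_cast
  congr 1 <;> ring

lemma alat (j : ℕ) (hj : 1 ≤ j) (a c α y : ℝ) (hy : phiPR a (j + 1) y = 0) : ∀ k : ℕ, k ≤ j →
    (paraRacahOdd j a c α (j + 1 + k)).eval y =
      -(α * deltaPR j a c) * (∏ i ∈ Finset.range k, uOdd j a c α (j - i)) *
        (paraRacahOdd j a c α (j - k)).eval y ∧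
    (paraRacahOdd j a c α (j + 2 + k)).eval y =
      -(α * deltaPR j a c) * (∏ i ∈ Finset.range k, uOdd j a c α (j - i)) *
        (uOdd j a c α (j - k) * (paraRacahOdd j a c α (j - k - 1)).eval y) := by
  intro k
  induction k with
  | zero =>
    intro _
    obtain ⟨i, rfl⟩ : ∃ i, j = i + 1 := ⟨j - 1, by omega⟩
    have ht := pSPR_top i a c y
    rw [hy, ← ev_eq (i + 1) a c α y _ le_rfl, ← ev_eq (i + 1) a c α y i (by omega)] at ht
    have hu := uOdd_gen (i + 1) a c α (i + 1) (by omega)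
    have hb : bOdd (i + 1) a c α (i + 1) = betaPR (i + 1) a c + α * deltaPR (i + 1) a c := by
      unfold bOdd betaPR deltaPR
      rw [if_pos rfl]; ring
    have hb' : bOdd (i + 1) a c α (i + 1 + 1) = betaPR (i + 1) a c + (1 - α) * deltaPR (i + 1) a c := by
      unfold bOdd betaPR deltaPR
      rw [if_neg (by omega), if_pos rfl]; ring
    have hu' : uOdd (i + 1) a c α (i + 1 + 1) = α * (1 - α) * deltaPR (i + 1) a c ^ 2 := by
      unfold uOdd deltaPR
      rw [if_pos rfl]; ring
    push_cast at hu
    rw [← hu] at ht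
    have h1 := ev_succ (i + 1) a c α y i
    have h2 := ev_succ (i + 1) a c α y (i + 1)
    rw [hb] at h1
    rw [hb', hu'] at h2
    have h1' : (paraRacahOdd (i + 1) a c α (i + 2)).eval y =
        -(α * deltaPR (i + 1) a c) * (paraRacahOdd (i + 1) a c α (i + 1)).eval y := by
      rw [h1]; linear_combination -ht
    simp only [Finset.range_zero, Finset.prod_empty, Nat.add_zero, Nat.sub_zero, mul_one, Nat.add_sub_cancel]
    refine ⟨h1', ?_⟩
    rw [show i + 1 + 2 = i + 1 + 2 from rfl, h2, show i + 1 + 1 = i + 2 from rfl, h1']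
    linear_combination (α * deltaPR (i + 1) a c) * ht
  | succ k ih =>
    intro hk
    obtain ⟨i1, i2⟩ := ih (by omega)
    rw [Finset.prod_range_succ]
    constructor
    · rw [show j + 1 + (k + 1) = j + 2 + k by ring, i2, Nat.sub_sub]
      ring
    · have h := ev_succ j a c α y (j + 1 + k)
      rw [show j + 2 + (k + 1) = j + 1 + k + 2 by ring, h, show j + 1 + k + 1 = j + 2 + k by ring,
        i1, i2, bOdd_sym j k a c α hk, uOdd_sym j k a c α hk, Nat.sub_add_eq]
      obtain ⟨m, hm⟩ : ∃ m, j - k = m + 1 := ⟨j - k - 1, by omega⟩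
      rw [hm, Nat.add_sub_cancel]
      cases m with
      | zero =>
        rw [uOdd_zero, zero_add, ev_one, ev_zero]
        ring
      | succ m =>
        rw [Nat.add_sub_cancel, ev_succ]
        ring

lemma favard (N : ℕ) (S : Finset ℕ) (b u : ℕ → ℝ) (y w : ℕ → ℝ) (E : ℕ → ℕ → ℝ)
    (h0 : ∀ s, E 0 s = 1) (h1 : ∀ s, E 1 s = y s - b 0)
    (hr : ∀ n s, E (n + 2) s = (y s - b (n + 1)) * E (n + 1) s - u (n + 1) * E n s)
    (hL : ∀ n ≤ N, ∑ s ∈ S, E n s * w s = if n = 0 then 1 else 0)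
    (hN : ∀ s ∈ S, E (N + 1) s = 0) :
    ∀ m n : ℕ, m ≤ n → m ≤ N → n ≤ N + 1 → ∑ s ∈ S, E m s * E n s * w s =
      if m = n then ∏ i ∈ Finset.Icc 1 n, u i else 0 := by
  intro m
  induction m using Nat.strong_induction_on with
  | _ m ih =>
    intro n hmn hm hn
    rcases Nat.lt_or_ge N n with hlt | hle
    · have : n = N + 1 := by omega
      subst this
      rw [if_neg (by omega), Finset.sum_eq_zero]
      intro s hs
      rw [hN s hs]; ring
    · match m, ih, hmn, hm with
      | 0, _, _, _ =>
        simp only [h0, one_mul]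
        rw [hL n hle]
        by_cases h : n = 0
        · subst h; simp
        · rw [if_neg h, if_neg (Ne.symm h)]
      | 1, ih, hmn, hm =>
        obtain ⟨n, rfl⟩ : ∃ n', n = n' + 1 := ⟨n - 1, by omega⟩
        have t1 := ih 0 (by omega) (n + 2) (by omega) (by omega) (by omega)
        have t2 := ih 0 (by omega) (n + 1) (by omega) (by omega) (by omega)
        have t3 := ih 0 (by omega) n (by omega) (by omega) (by omega)
        have : ∑ s ∈ S, E 1 s * E (n + 1) s * w s = ∑ s ∈ S, E 0 s * E (n + 2) s * w s +
            (b (n + 1) - b 0) * ∑ s ∈ S, E 0 s * E (n + 1) s * w s +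
            u (n + 1) * ∑ s ∈ S, E 0 s * E n s * w s := by
          rw [Finset.mul_sum, Finset.mul_sum, ← Finset.sum_add_distrib, ← Finset.sum_add_distrib]
          apply Finset.sum_congr rfl
          intro s _
          rw [hr, h1, h0]; ring
        rw [this, t1, t2, t3, if_neg (by omega), if_neg (by omega)]
        by_cases h : n = 0
        · subst h; simp
        · rw [if_neg (by omega), if_neg (by omega)]; ring
      | m + 2, ih, hmn, hm =>
        obtain ⟨n, rfl⟩ : ∃ n', n = n' + 1 := ⟨n - 1, by omega⟩
        have t1 := ih (m + 1) (by omega) (n + 2) (by omega) (by omega) (by omega)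
        have t2 := ih (m + 1) (by omega) (n + 1) (by omega) (by omega) (by omega)
        have t3 := ih (m + 1) (by omega) n (by omega) (by omega) (by omega)
        have t4 := ih m (by omega) (n + 1) (by omega) (by omega) (by omega)
        have : ∑ s ∈ S, E (m + 2) s * E (n + 1) s * w s = ∑ s ∈ S, E (m + 1) s * E (n + 2) s * w s +
            (b (n + 1) - b (m + 1)) * ∑ s ∈ S, E (m + 1) s * E (n + 1) s * w s +
            u (n + 1) * ∑ s ∈ S, E (m + 1) s * E n s * w s
            - u (m + 1) * ∑ s ∈ S, E m s * E (n + 1) s * w s := by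
          rw [Finset.mul_sum, Finset.mul_sum, Finset.mul_sum, ← Finset.sum_add_distrib, ← Finset.sum_add_distrib,
            ← Finset.sum_sub_distrib]
          apply Finset.sum_congr rfl
          intro s _
          rw [hr, hr]; ring
        rw [this, t1, t2, t3, t4, if_neg (by omega), if_neg (by omega), if_neg (show ¬ m = n + 1 by omega)]
        by_cases h : m + 1 = n
        · rw [if_pos h, if_pos (by omega), Finset.prod_Icc_succ_top (by omega)]; ring
        · rw [if_neg h, if_neg (by omega)]; ring

lemma sum_even_odd (f : ℕ → ℝ) (m : ℕ) : ∑ s ∈ Finset.range (2 * m), f s =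
    ∑ s ∈ Finset.range m, f (2 * s) + ∑ s ∈ Finset.range m, f (2 * s + 1) := by
  induction m with
  | zero => simp
  | succ m ih =>
    rw [show 2 * (m + 1) = 2 * m + 1 + 1 by ring, Finset.sum_range_succ, Finset.sum_range_succ, ih,
      Finset.sum_range_succ, Finset.sum_range_succ]
    ring

lemma biLattice_even (a c : ℝ) (s : ℕ) : biLattice a c (2 * s) = -((s : ℝ) + a) ^ 2 := by
  unfold biLattice
  rw [if_pos (by omega), show 2 * s / 2 = s by omega]

lemma biLattice_odd (a c : ℝ) (s : ℕ) : biLattice a c (2 * s + 1) = -((s : ℝ) + c) ^ 2 := by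
  unfold biLattice
  rw [if_neg (by omega), show (2 * s + 1) / 2 = s by omega]

lemma wOdd_even (j : ℕ) (a c α : ℝ) (s : ℕ) : wOdd j a c α (2 * s) = (1 - α) * WA j a c s := by
  unfold wOdd WA
  rw [if_pos (by omega), show 2 * s / 2 = s by omega, ← mul_div_assoc]
  congr 1
  ring

lemma kappa_swap (j : ℕ) (a c : ℝ) : kappaOdd j c a = -kappaOdd j a c := by
  unfold kappaOdd
  have h : poch (c - a - j) (2 * j + 1) = -poch (a - c - j) (2 * j + 1) := by
    rw [poch_reflect, pow_succ, pow_mul]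
    push_cast
    rw [show -(c - a - (j : ℝ)) - 2 * j = a - c - j by ring]
    norm_num
  rw [h, add_comm c a]
  ring

lemma wOdd_odd (j : ℕ) (a c α : ℝ) (s : ℕ) : wOdd j a c α (2 * s + 1) = α * WA j c a s := by
  unfold wOdd WA
  rw [if_neg (by omega), show (2 * s + 1) / 2 = s by omega, ← mul_div_assoc, kappa_swap, add_comm c a]
  congr 1
  ring

lemma good_of (j : ℕ) (hj : 1 ≤ j) (a c : ℝ) (hp₁ : poch (a + c) (j + 1) ≠ 0) (hp₂ : poch (c - a) (j + 1) ≠ 0)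
    (hp₃ : poch (a - c) (j + 1) ≠ 0) (hp₄ : poch (2 * a + 1) j ≠ 0) (hp₆ : poch a j ≠ 0)
    (hp₇ : poch (2 * a + 1 + j) j ≠ 0) (hp₉ : poch (a + c + j + 1) j ≠ 0) : GoodPR j a c := by
  have h3 : ∀ i : ℕ, i < 2 * j → 2 * a + 1 + i ≠ 0 := by
    have : poch (2 * a + 1) (2 * j) ≠ 0 := by
      rw [two_mul j, poch_add]; exact mul_ne_zero hp₄ hp₇
    exact (poch_ne_iff _ _).mp this
  refine ⟨?_, ?_, ?_, h3, ?_⟩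
  · have : poch (a + c) (j + 1 + j) ≠ 0 := by
      rw [poch_add]
      refine mul_ne_zero hp₁ ?_
      push_cast
      rwa [← add_assoc]
    intro i hi
    exact (poch_ne_iff _ _).mp this i (by omega)
  · intro i hi
    exact (poch_ne_iff _ _).mp hp₃ i (by omega)
  · intro i hi
    exact (poch_ne_iff _ _).mp hp₂ i (by omega)
  · intro i hi
    rcases Nat.lt_or_ge i j with h | h
    · exact (poch_ne_iff _ _).mp hp₆ i h
    · have e : i = j := le_antisymm hi h
      subst e
      have := h3 (2 * i - 1) (by omega)
      rw [Nat.cast_sub (by omega)] at this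
      push_cast at this
      intro h0; apply this; linarith

theorem paraRacahOdd_orthogonality (j : ℕ) (hj : 1 ≤ j) (a c α : ℝ)
    (hα₀ : 0 < α) (hα₁ : α < 1) (hac : a ≠ c) (hacj : a + c + (j : ℝ) ≠ 0)
    (hcase :
      (-(2 * (j : ℝ) + 1) < a + c ∧ a + c < -(j : ℝ) + 1 ∧ |c - a| > (j : ℝ)) ∨
      ((a + c < -(2 * (j : ℝ) + 1) + 1 ∨ 0 < a + c) ∧ |c - a| < 1))
    (hdist : ∀ s t : ℕ, s ≤ 2 * j + 1 → t ≤ 2 * j + 1 →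
      biLattice a c s = biLattice a c t → s = t)
    (hp₁ : poch (a + c) (j + 1) ≠ 0) (hp₂ : poch (c - a) (j + 1) ≠ 0)
    (hp₃ : poch (a - c) (j + 1) ≠ 0) (hp₄ : poch (2 * a + 1) j ≠ 0)
    (hp₅ : poch (2 * c + 1) j ≠ 0) (hp₆ : poch a j ≠ 0)
    (hp₇ : poch (2 * a + 1 + j) j ≠ 0) (hp₈ : poch (a - c + 1) j ≠ 0)
    (hp₉ : poch (a + c + j + 1) j ≠ 0) (hp₁₀ : poch c j ≠ 0)
    (hp₁₁ : poch (2 * c + 1 + j) j ≠ 0) (hp₁₂ : poch (c - a + 1) j ≠ 0) :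
    ∀ n m : ℕ, n ≤ 2 * j + 1 → m ≤ 2 * j + 1 →
      ∑ s ∈ Finset.range (2 * j + 2),
          (paraRacahOdd j a c α n).eval (biLattice a c s) *
            (paraRacahOdd j a c α m).eval (biLattice a c s) * wOdd j a c α s =
        (∏ i ∈ Finset.Icc 1 n, uOdd j a c α i) * (if n = m then 1 else 0) := by
  have ga : GoodPR j a c := good_of j hj a c hp₁ hp₂ hp₃ hp₄ hp₆ hp₇ hp₉
  have gc : GoodPR j c a := good_of j hj c a (by rwa [add_comm c a]) hp₃ hp₂ hp₅ hp₁₀ hp₁₁ (by rwa [add_comm c a])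
  have hya : ∀ s : ℕ, s ≤ j → phiPR a (j + 1) (-((s : ℝ) + a) ^ 2) = 0 :=
    fun s hs => phi_zero a (j + 1) s (by omega)
  have hyc : ∀ s : ℕ, s ≤ j → phiPR c (j + 1) (-((s : ℝ) + c) ^ 2) = 0 :=
    fun s hs => phi_zero c (j + 1) s (by omega)
  have hswap : ∀ n, paraRacahOdd j a c α n = paraRacahOdd j c a (1 - α) n :=
    paraRacahOdd_swap j a c α
  have hδ : deltaPR j c a = -deltaPR j a c := by unfold deltaPR; ring
  have hu : ∀ n, uOdd j c a (1 - α) n = uOdd j a c α n := by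
    intro k
    unfold uOdd
    split_ifs
    · ring
    · congr 1; ring
  -- values on the two sublattices
  have hA : ∀ s : ℕ, s ≤ j → ∀ k : ℕ, k ≤ j → _ := fun s hs => alat j hj a c α _ (hya s hs)
  have hC : ∀ s : ℕ, s ≤ j → ∀ k : ℕ, k ≤ j → _ := fun s hs => alat j hj c a (1 - α) _ (hyc s hs)
  simp only [← hswap, hu, hδ] at hC
  have hN : ∀ s ∈ Finset.range (2 * j + 2),
      (paraRacahOdd j a c α (2 * j + 1 + 1)).eval (biLattice a c s) = 0 := by
    intro s hs
    have hs := Finset.mem_range.mp hs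
    rcases Nat.even_or_odd' s with ⟨t, rfl | rfl⟩
    · rw [biLattice_even]
      have := (hA t (by omega) j le_rfl).2
      rw [Nat.sub_self, uOdd_zero] at this
      rw [show 2 * j + 1 + 1 = j + 2 + j by ring, this]; ring
    · rw [biLattice_odd]
      have := (hC t (by omega) j le_rfl).2
      rw [Nat.sub_self, uOdd_zero] at this
      rw [show 2 * j + 1 + 1 = j + 2 + j by ring, this]; ring
  have hLa : ∀ n ≤ j, ∑ s ∈ Finset.range (j + 1),
      (paraRacahOdd j a c α n).eval (-((s : ℝ) + a) ^ 2) * WA j a c s = if n = 0 then 1 else 0 := by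
    intro n hn
    rw [← LA_pS j a c ga hj n hn]
    apply Finset.sum_congr rfl
    intro s _
    rw [ev_eq j a c α _ n hn]; ring
  have hLc : ∀ n ≤ j, ∑ s ∈ Finset.range (j + 1),
      (paraRacahOdd j a c α n).eval (-((s : ℝ) + c) ^ 2) * WA j c a s = if n = 0 then 1 else 0 := by
    intro n hn
    rw [← LA_pS j c a gc hj n hn]
    apply Finset.sum_congr rfl
    intro s _
    rw [hswap, ev_eq j c a (1 - α) _ n hn]; ring
  have hL : ∀ n ≤ 2 * j + 1, ∑ s ∈ Finset.range (2 * j + 2),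
      (paraRacahOdd j a c α n).eval (biLattice a c s) * wOdd j a c α s = if n = 0 then 1 else 0 := by
    intro n hn
    rw [show 2 * j + 2 = 2 * (j + 1) by ring, sum_even_odd]
    simp only [biLattice_even, biLattice_odd, wOdd_even, wOdd_odd]
    rcases Nat.lt_or_ge j n with h | h
    · obtain ⟨k, rfl⟩ := Nat.exists_eq_add_of_le h
      have hk : k ≤ j := by omega
      rw [if_neg (by omega)]
      set R := ∏ i ∈ Finset.range k, uOdd j a c α (j - i) with hR
      have s1 : ∑ s ∈ Finset.range (j + 1), (paraRacahOdd j a c α (j + 1 + k)).eval (-((s : ℝ) + a) ^ 2) *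
          ((1 - α) * WA j a c s) = (-(α * deltaPR j a c) * R * (1 - α)) * if j - k = 0 then 1 else 0 := by
        rw [← hLa (j - k) (by omega), Finset.mul_sum]
        apply Finset.sum_congr rfl
        intro s hs
        rw [(hA s (Nat.lt_succ_iff.mp (Finset.mem_range.mp hs)) k hk).1]
        ring
      have s2 : ∑ s ∈ Finset.range (j + 1), (paraRacahOdd j a c α (j + 1 + k)).eval (-((s : ℝ) + c) ^ 2) *
          (α * WA j c a s) = (-((1 - α) * -deltaPR j a c) * R * α) * if j - k = 0 then 1 else 0 := by
        rw [← hLc (j - k) (by omega), Finset.mul_sum]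
        apply Finset.sum_congr rfl
        intro s hs
        rw [(hC s (Nat.lt_succ_iff.mp (Finset.mem_range.mp hs)) k hk).1]
        ring
      rw [show j.succ + k = j + 1 + k from rfl, s1, s2]
      ring
    · have s1 : ∑ s ∈ Finset.range (j + 1), (paraRacahOdd j a c α n).eval (-((s : ℝ) + a) ^ 2) *
          ((1 - α) * WA j a c s) = (1 - α) * if n = 0 then 1 else 0 := by
        rw [← hLa n h, Finset.mul_sum]
        apply Finset.sum_congr rfl
        intro s hs
        ring
      have s2 : ∑ s ∈ Finset.range (j + 1), (paraRacahOdd j a c α n).eval (-((s : ℝ) + c) ^ 2) *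
          (α * WA j c a s) = α * if n = 0 then 1 else 0 := by
        rw [← hLc n h, Finset.mul_sum]
        apply Finset.sum_congr rfl
        intro s hs
        ring
      rw [s1, s2]
      ring
  have hF := favard (2 * j + 1) (Finset.range (2 * j + 2)) (bOdd j a c α) (uOdd j a c α) (biLattice a c)
    (wOdd j a c α) (fun n s => (paraRacahOdd j a c α n).eval (biLattice a c s))
    (fun s => ev_zero j a c α _) (fun s => ev_one j a c α _) (fun n s => ev_succ j a c α _ n) hL hN
  intro n m hn hm
  rcases Nat.le_total n m with h | h
  · have := hF n m h hn (by omega)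
    rw [this]
    by_cases e : n = m
    · subst e; simp
    · simp [e]
  · have := hF m n h hm (by omega)
    have hc : ∑ s ∈ Finset.range (2 * j + 2),
          (paraRacahOdd j a c α n).eval (biLattice a c s) *
            (paraRacahOdd j a c α m).eval (biLattice a c s) * wOdd j a c α s =
        ∑ s ∈ Finset.range (2 * j + 2),
          (paraRacahOdd j a c α m).eval (biLattice a c s) *
            (paraRacahOdd j a c α n).eval (biLattice a c s) * wOdd j a c α s := by
      apply Finset.sum_congr rfl
      intro s _
      ring
    rw [hc, this]
    by_cases e : n = m
    · subst e; simp
    · simp [e, Ne.symm e]
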